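/- Let d ≥ 2 be an integer and α ∈ (0,2). The function F_{R_v} : [0,1] → ℝ defined by F_{R_v}(r) = I(r^2; d/2, α/2) + r^α · (B(d/2-α/2, α/2)/B(d/2, α/2)) · (1 - I(r^2; d/2-α/2, α/2)) is continuous and strictly increasing on [0,1], with F_{R_v}(0) = 0 and F_{R_v}(1) = 1; in particular it is a bijection from [0,1] onto [0,1]. -/

import Mathlib

open Real MeasureTheory

/-- Beta function B(z,w) = Γ(z)Γ(w)/Γ(z+w). -/
noncomputable def betaFn (z w : ℝ) : ℝ :=
  Real.Gamma z * Real.Gamma w / Real.Gamma (z + w)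

/-- Regularized incomplete Beta function I(x; z, w). -/
noncomputable def regIncBeta (x z w : ℝ) : ℝ :=
  (∫ u in (0:ℝ)..x, u ^ (z - 1) * (1 - u) ^ (w - 1)) / betaFn z w

/-- F_{R_v}(r) = I(r²; d/2, α/2) + r^α (B(d/2-α/2,α/2)/B(d/2,α/2)) (1 - I(r²; d/2-α/2, α/2)). -/
noncomputable def F_Rv (d : ℕ) (α : ℝ) (r : ℝ) : ℝ :=
  regIncBeta (r^2) ((d:ℝ)/2) (α/2)
    + r ^ α * (betaFn ((d:ℝ)/2 - α/2) (α/2) / betaFn ((d:ℝ)/2) (α/2))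
        * (1 - regIncBeta (r^2) ((d:ℝ)/2 - α/2) (α/2))

open Set intervalIntegral

/-- The unnormalized Beta density. -/
noncomputable def betaIntegrand (z w u : ℝ) : ℝ :=
  u ^ (z - 1) * (1 - u) ^ (w - 1)

/-- For `x ∈ [0, 1]` this is `∫ u in 0..1, min 1 ((x / u) ^ w) * betaIntegrand z w u`. -/
noncomputable def truncatedBeta (z w x : ℝ) : ℝ :=
  (∫ u in (0:ℝ)..x, betaIntegrand z w u) + x ^ w * ∫ u in x..1, betaIntegrand (z - w) w u

theorem ofReal_betaIntegrand {z w u : ℝ} (hu : u ∈ Icc (0:ℝ) 1) :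
    (betaIntegrand z w u : ℂ) = (u : ℂ) ^ ((z : ℂ) - 1) * (1 - (u : ℂ)) ^ ((w : ℂ) - 1) := by
  rw [betaIntegrand, Complex.ofReal_mul, Complex.ofReal_cpow hu.1,
    Complex.ofReal_cpow (sub_nonneg.2 hu.2)]
  push_cast
  rfl

theorem intervalIntegrable_betaIntegrand {z w : ℝ} (hz : 0 < z) (hw : 0 < w) :
    IntervalIntegrable (betaIntegrand z w) volume 0 1 := by
  have h := Complex.betaIntegral_convergent (u := (z : ℂ)) (v := (w : ℂ)) (by simpa) (by simpa)
  have h' : IntervalIntegrable (fun u ↦ (betaIntegrand z w u : ℂ)) volume 0 1 := by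
    refine h.congr fun u hu ↦ ?_
    rw [uIoc_of_le zero_le_one] at hu
    exact (ofReal_betaIntegrand (Ioc_subset_Icc_self hu)).symm
  exact ⟨h'.1.re, h'.2.re⟩

theorem intervalIntegrable_betaIntegrand_of_mem {z w x y : ℝ} (hz : 0 < z) (hw : 0 < w)
    (hx : x ∈ Icc (0:ℝ) 1) (hy : y ∈ Icc (0:ℝ) 1) :
    IntervalIntegrable (betaIntegrand z w) volume x y := by
  refine (intervalIntegrable_betaIntegrand hz hw).mono_set ?_
  rw [uIcc_of_le zero_le_one]
  exact uIcc_subset_Icc hx hy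

theorem integral_betaIntegrand {z w : ℝ} (hz : 0 < z) (hw : 0 < w) :
    ∫ u in (0:ℝ)..1, betaIntegrand z w u = betaFn z w := by
  have h : Complex.betaIntegral z w = ((∫ u in (0:ℝ)..1, betaIntegrand z w u : ℝ) : ℂ) := by
    rw [Complex.betaIntegral, ← intervalIntegral.integral_ofReal]
    refine integral_congr fun u hu ↦ ?_
    rw [uIcc_of_le zero_le_one] at hu
    exact (ofReal_betaIntegrand hu).symm
  have hbeta := ProbabilityTheory.beta_eq_betaIntegralReal z w hz hw
  rw [h, Complex.ofReal_re] at hbeta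
  exact hbeta.symm

theorem betaFn_pos {z w : ℝ} (hz : 0 < z) (hw : 0 < w) : 0 < betaFn z w :=
  ProbabilityTheory.beta_pos hz hw

theorem betaIntegrand_pos {z w u : ℝ} (hu : u ∈ Ioo (0:ℝ) 1) : 0 < betaIntegrand z w u :=
  mul_pos (rpow_pos_of_pos hu.1 _) (rpow_pos_of_pos (sub_pos.2 hu.2) _)

theorem betaIntegrand_nonneg {z w u : ℝ} (hu : u ∈ Icc (0:ℝ) 1) : 0 ≤ betaIntegrand z w u :=
  mul_nonneg (rpow_nonneg hu.1 _) (rpow_nonneg (sub_nonneg.2 hu.2) _)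

theorem betaIntegrand_eq_rpow_mul {z w u : ℝ} (hu : 0 < u) :
    betaIntegrand z w u = u ^ w * betaIntegrand (z - w) w u := by
  rw [betaIntegrand, betaIntegrand, ← mul_assoc, ← rpow_add hu]
  ring_nf

theorem continuousOn_truncatedBeta {z w : ℝ} (hw : 0 < w) (hwz : w < z) :
    ContinuousOn (truncatedBeta z w) (Icc (0:ℝ) 1) := by
  have h₁ := continuousOn_primitive_interval'
    (intervalIntegrable_betaIntegrand (hw.trans hwz) hw) left_mem_uIcc
  have h₂ := continuousOn_primitive_interval'
    (intervalIntegrable_betaIntegrand (sub_pos.2 hwz) hw) right_mem_uIcc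
  rw [uIcc_of_le zero_le_one] at h₁ h₂
  refine h₁.add ((continuous_rpow_const hw.le).continuousOn.mul ?_)
  exact h₂.neg.congr fun x _ ↦ integral_symm 1 x

theorem strictMonoOn_truncatedBeta {z w : ℝ} (hw : 0 < w) (hwz : w < z) :
    StrictMonoOn (truncatedBeta z w) (Icc (0:ℝ) 1) := by
  intro x hx y hy hxy
  have h0 : (0:ℝ) ∈ Icc (0:ℝ) 1 := by simp
  have h1 : (1:ℝ) ∈ Icc (0:ℝ) 1 := by simp
  have hz : 0 < z := hw.trans hwz
  have hzw : 0 < z - w := sub_pos.2 hwz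
  have hadd₁ := integral_add_adjacent_intervals
    (intervalIntegrable_betaIntegrand_of_mem hz hw h0 hx)
    (intervalIntegrable_betaIntegrand_of_mem hz hw hx hy)
  have hadd₂ := integral_add_adjacent_intervals
    (intervalIntegrable_betaIntegrand_of_mem hzw hw hx hy)
    (intervalIntegrable_betaIntegrand_of_mem hzw hw hy h1)
  have hint₁ := intervalIntegrable_betaIntegrand_of_mem hz hw hx hy
  have hint₂ := (intervalIntegrable_betaIntegrand_of_mem hzw hw hx hy).const_mul (x ^ w)
  have hpos : 0 < ∫ u in x..y, (betaIntegrand z w u - x ^ w * betaIntegrand (z - w) w u) := by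
    refine intervalIntegral_pos_of_pos_on (hint₁.sub hint₂) (fun u hu ↦ ?_) hxy
    have hu0 : 0 < u := hx.1.trans_lt hu.1
    rw [betaIntegrand_eq_rpow_mul hu0, ← sub_mul]
    exact mul_pos (sub_pos.2 (rpow_lt_rpow hx.1 hu.1 hw))
      (betaIntegrand_pos ⟨hu0, hu.2.trans_le hy.2⟩)
  rw [intervalIntegral.integral_sub hint₁ hint₂, intervalIntegral.integral_const_mul] at hpos
  have hnonneg : 0 ≤ (y ^ w - x ^ w) * ∫ u in y..1, betaIntegrand (z - w) w u :=
    mul_nonneg (sub_nonneg.2 (rpow_le_rpow hx.1 hxy.le hw.le))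
      (integral_nonneg hy.2 fun u hu ↦ betaIntegrand_nonneg ⟨hy.1.trans hu.1, hu.2⟩)
  rw [truncatedBeta, truncatedBeta, ← hadd₁, ← hadd₂]
  linarith

theorem truncatedBeta_zero {z w : ℝ} (hw : 0 < w) : truncatedBeta z w 0 = 0 := by
  simp [truncatedBeta, zero_rpow hw.ne']

theorem truncatedBeta_one {z w : ℝ} (hz : 0 < z) (hw : 0 < w) :
    truncatedBeta z w 1 = betaFn z w := by
  simp [truncatedBeta, integral_betaIntegrand hz hw]

theorem regIncBeta_eq_integral_div (x z w : ℝ) :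
    regIncBeta x z w = (∫ u in (0:ℝ)..x, betaIntegrand z w u) / betaFn z w :=
  rfl

theorem F_Rv_eq_truncatedBeta_div {d : ℕ} {α r : ℝ} (hα : 0 < α) (hαd : α < d)
    (hr : r ∈ Icc (0:ℝ) 1) :
    F_Rv d α r = truncatedBeta (d / 2) (α / 2) (r ^ 2) / betaFn (d / 2) (α / 2) := by
  have hw : 0 < α / 2 := half_pos hα
  have hzw : 0 < (d:ℝ) / 2 - α / 2 := by linarith
  have hr2 : r ^ 2 ∈ Icc (0:ℝ) 1 := ⟨sq_nonneg r, pow_le_one₀ hr.1 hr.2⟩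
  have hadd := integral_add_adjacent_intervals
    (intervalIntegrable_betaIntegrand_of_mem hzw hw (left_mem_Icc.2 zero_le_one) hr2)
    (intervalIntegrable_betaIntegrand_of_mem hzw hw hr2 (right_mem_Icc.2 zero_le_one))
  rw [integral_betaIntegrand hzw hw] at hadd
  have hpow : (r ^ 2) ^ (α / 2) = r ^ α := by
    rw [← rpow_natCast_mul hr.1]
    congr 1
    push_cast
    ring
  have hB := (betaFn_pos hzw hw).ne'
  have hB' := (betaFn_pos (show 0 < (d:ℝ) / 2 by linarith) hw).ne'
  rw [F_Rv, truncatedBeta, hpow, regIncBeta_eq_integral_div, regIncBeta_eq_integral_div,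
    eq_sub_of_add_eq' hadd]
  generalize betaFn ((d:ℝ) / 2 - α / 2) (α / 2) = B at hB ⊢
  field_simp

theorem stmt11 (d : ℕ) (hd : 2 ≤ d) (α : ℝ) (hα : α ∈ Set.Ioo (0:ℝ) 2) :
    ContinuousOn (F_Rv d α) (Set.Icc (0:ℝ) 1) ∧
    StrictMonoOn (F_Rv d α) (Set.Icc (0:ℝ) 1) ∧
    F_Rv d α 0 = 0 ∧ F_Rv d α 1 = 1 ∧
    Set.BijOn (F_Rv d α) (Set.Icc (0:ℝ) 1) (Set.Icc (0:ℝ) 1) := by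
  have hdR : (2:ℝ) ≤ d := by exact_mod_cast hd
  have hw : 0 < α / 2 := half_pos hα.1
  have hαd : α < d := hα.2.trans_le hdR
  have hwz : α / 2 < (d:ℝ) / 2 := by linarith
  have hB := betaFn_pos (hw.trans hwz) hw
  have hF : EqOn (F_Rv d α)
      (fun r ↦ truncatedBeta (d / 2) (α / 2) (r ^ 2) / betaFn (d / 2) (α / 2)) (Icc 0 1) :=
    fun r hr ↦ F_Rv_eq_truncatedBeta_div hα.1 hαd hr
  have hsq : MapsTo (fun r : ℝ ↦ r ^ 2) (Icc 0 1) (Icc 0 1) :=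
    fun r hr ↦ ⟨sq_nonneg r, pow_le_one₀ hr.1 hr.2⟩
  have hcont : ContinuousOn (F_Rv d α) (Icc (0:ℝ) 1) :=
    (((continuousOn_truncatedBeta hw hwz).comp (continuous_pow 2).continuousOn hsq).div_const
      _).congr hF
  have hmono : StrictMonoOn (F_Rv d α) (Icc (0:ℝ) 1) := by
    intro x hx y hy hxy
    rw [hF hx, hF hy]
    exact div_lt_div_of_pos_right (strictMonoOn_truncatedBeta hw hwz (hsq hx) (hsq hy)
      (pow_lt_pow_left₀ hxy hx.1 two_ne_zero)) hB
  have hzero : F_Rv d α 0 = 0 := by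
    rw [hF (by simp)]
    simp [truncatedBeta_zero hw]
  have hone : F_Rv d α 1 = 1 := by
    rw [hF (by simp)]
    simp [truncatedBeta_one (hw.trans hwz) hw, hB.ne']
  refine ⟨hcont, hmono, hzero, hone, ?_, hmono.injOn, ?_⟩
  · simpa only [hzero, hone] using hmono.monotoneOn.mapsTo_Icc
  · simpa only [hzero, hone] using! intermediate_value_Icc zero_le_one hcont
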